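/- Marcinkiewicz equality: for every projection P ∈ 𝒫(C(2π), Π_n), every f ∈ C(2π), and every t ∈ [0, 2π], one has F_n f(t) = (1/2π) ∫_0^{2π} (T_{g^{-1}} P T_g f)(t) dg, where (T_g f)(t) = f(t+g) denotes translation by g and the integral is with respect to Lebesgue measure. -/

import Mathlib

open MeasureTheory
open scoped Real ENNReal

instance : Fact (0 < 2 * π) := ⟨by positivity⟩

/-- `C(2π)`: continuous `2π`-periodic real-valued functions with the sup norm. -/
abbrev C2pi : Type := C(AddCircle (2 * π), ℝ)

/-- `cos (k t)` as an element of `C(2π)`. -/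
noncomputable def cosF (k : ℕ) : C2pi :=
  ⟨fun t => (fourier (T := 2 * π) k t).re, (Complex.continuous_re.comp (map_continuous _))⟩

/-- `sin (k t)` as an element of `C(2π)`. -/
noncomputable def sinF (k : ℕ) : C2pi :=
  ⟨fun t => (fourier (T := 2 * π) k t).im, (Complex.continuous_im.comp (map_continuous _))⟩

/-- `Π_n`: the space of trigonometric polynomials of degree at most `n`. -/
noncomputable def trigPoly (n : ℕ) : Submodule ℝ C2pi :=
  Submodule.span ℝ {f : C2pi | ∃ k : ℕ, k ≤ n ∧ (f = cosF k ∨ f = sinF k)}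

/-- The `L²`-inner-product coefficient functional `f ↦ ∫₀^{2π} f(t) g(t) dt`. -/
noncomputable def coeffCLM (g : C2pi) : C2pi →L[ℝ] ℝ :=
  (innerSL ℝ (ContinuousMap.toLp (E := ℝ) 2 volume ℝ g)).comp
    (ContinuousMap.toLp (E := ℝ) 2 volume ℝ)

/-- The Fourier projection `F_n : C(2π) → Π_n`, sending `f` to its `n`-th Fourier
partial sum. -/
noncomputable def fourierProj (n : ℕ) : C2pi →L[ℝ] C2pi :=
  (1 / (2 * π)) • (coeffCLM (cosF 0)).smulRight (cosF 0) +
    ∑ k ∈ Finset.Icc 1 n,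
      ((1 / π) • ((coeffCLM (cosF k)).smulRight (cosF k) +
        (coeffCLM (sinF k)).smulRight (sinF k)))

/-- Translation operator `(T_g f)(t) = f(t + g)` on `C(2π)`. -/
noncomputable def translateBy (g : ℝ) (f : C2pi) : C2pi :=
  f.comp ⟨fun t => t + (g : AddCircle (2 * π)), by continuity⟩

open AddCircle

lemma integral_fourier_two_pi (m : ℤ) :
    ∫ x : AddCircle (2 * π), fourier m x = if m = 0 then 2 * (π : ℂ) else 0 := by
  split_ifs with h
  · subst h
    simp [Measure.real, AddCircle.measure_univ, ENNReal.toReal_ofReal Real.pi_pos.le]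
  · exact integral_eq_zero_of_add_right_eq_neg
      (fourier_add_half_inv_index h (Fact.out : (0 : ℝ) < 2 * π))

lemma integrable_C2pi (f : C2pi) : Integrable (fun x => f x) :=
  f.continuous.integrable_of_hasCompactSupport (HasCompactSupport.of_compactSpace _)

lemma integrable_fourier_two_pi (m : ℤ) :
    Integrable (fun x : AddCircle (2 * π) => fourier m x) :=
  (map_continuous (fourier m)).integrable_of_hasCompactSupport (HasCompactSupport.of_compactSpace _)

lemma integral_re_fourier (m : ℤ) :
    ∫ x : AddCircle (2 * π), (fourier m x).re = if m = 0 then 2 * π else 0 := by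
  have h := Complex.reCLM.integral_comp_comm (integrable_fourier_two_pi m)
  simp only [Complex.reCLM_apply, integral_fourier_two_pi] at h
  rw [h]
  split_ifs <;> simp

lemma integral_im_fourier (m : ℤ) :
    ∫ x : AddCircle (2 * π), (fourier m x).im = 0 := by
  have h := Complex.imCLM.integral_comp_comm (integrable_fourier_two_pi m)
  simp only [Complex.imCLM_apply, integral_fourier_two_pi] at h
  rw [h]
  split_ifs <;> simp

lemma cosF_apply (k : ℕ) (x : AddCircle (2 * π)) : cosF k x = (fourier (k : ℤ) x).re := rfl

lemma sinF_apply (k : ℕ) (x : AddCircle (2 * π)) : sinF k x = (fourier (k : ℤ) x).im := rfl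

lemma integrable_re_fourier (m : ℤ) :
    Integrable (fun x : AddCircle (2 * π) => (fourier m x).re) :=
  (integrable_fourier_two_pi m).re

lemma integrable_im_fourier (m : ℤ) :
    Integrable (fun x : AddCircle (2 * π) => (fourier m x).im) :=
  (integrable_fourier_two_pi m).im

lemma integral_cosF_mul_cosF (j k : ℕ) :
    ∫ x, cosF j x * cosF k x =
      ((if (j : ℤ) + k = 0 then 2 * π else 0) + (if j = k then 2 * π else 0)) / 2 := by
  have h (x : AddCircle (2 * π)) : cosF j x * cosF k x =
      ((fourier ((j : ℤ) + k) x).re + (fourier ((j : ℤ) + -k) x).re) / 2 := by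
    rw [fourier_add, fourier_add, fourier_neg, cosF_apply, cosF_apply]
    simp only [Complex.mul_re, Complex.conj_re, Complex.conj_im]
    ring
  simp_rw [h]
  rw [integral_div, integral_add (integrable_re_fourier _) (integrable_re_fourier _),
    integral_re_fourier, integral_re_fourier]
  simp only [← sub_eq_add_neg, sub_eq_zero, Nat.cast_inj]

lemma integral_sinF_mul_sinF (j k : ℕ) :
    ∫ x, sinF j x * sinF k x =
      ((if j = k then 2 * π else 0) - (if (j : ℤ) + k = 0 then 2 * π else 0)) / 2 := by
  have h (x : AddCircle (2 * π)) : sinF j x * sinF k x =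
      ((fourier ((j : ℤ) + -k) x).re - (fourier ((j : ℤ) + k) x).re) / 2 := by
    rw [fourier_add, fourier_add, fourier_neg, sinF_apply, sinF_apply]
    simp only [Complex.mul_re, Complex.conj_re, Complex.conj_im]
    ring
  simp_rw [h]
  rw [integral_div, integral_sub (integrable_re_fourier _) (integrable_re_fourier _),
    integral_re_fourier, integral_re_fourier]
  simp only [← sub_eq_add_neg, sub_eq_zero, Nat.cast_inj]

lemma integral_sinF_mul_cosF (j k : ℕ) : ∫ x, sinF j x * cosF k x = 0 := by
  have h (x : AddCircle (2 * π)) : sinF j x * cosF k x =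
      ((fourier ((j : ℤ) + k) x).im + (fourier ((j : ℤ) + -k) x).im) / 2 := by
    rw [fourier_add, fourier_add, fourier_neg, sinF_apply, cosF_apply]
    simp only [Complex.mul_im, Complex.conj_re, Complex.conj_im]
    ring
  simp_rw [h]
  rw [integral_div, integral_add (integrable_im_fourier _) (integrable_im_fourier _),
    integral_im_fourier, integral_im_fourier]
  simp

lemma integral_cosF_mul_sinF (j k : ℕ) : ∫ x, cosF j x * sinF k x = 0 := by
  simp_rw [mul_comm (cosF j _)]
  exact integral_sinF_mul_cosF k j

lemma coeffCLM_apply (g f : C2pi) : coeffCLM g f = ∫ x, g x * f x := by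
  have h := ContinuousMap.inner_toLp (𝕜 := ℝ) (volume : Measure (AddCircle (2 * π))) g f
  simp only [conj_trivial, mul_comm (f _)] at h
  exact h

lemma sinF_zero : sinF 0 = 0 := by
  ext x
  simp [sinF_apply]

lemma fourierProj_apply (n : ℕ) (f : C2pi) : fourierProj n f =
    ((1 / (2 * π)) * coeffCLM (cosF 0) f) • cosF 0 + ∑ k ∈ Finset.Icc 1 n,
      (1 / π) • (coeffCLM (cosF k) f • cosF k + coeffCLM (sinF k) f • sinF k) := by
  simp [fourierProj, smul_smul]

lemma fourierProj_cosF (n k : ℕ) : fourierProj n (cosF k) = if k ≤ n then cosF k else 0 := by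
  have hpi := Real.pi_ne_zero
  rw [fourierProj_apply]
  simp only [coeffCLM_apply, integral_cosF_mul_cosF, integral_sinF_mul_cosF]
  rcases Nat.eq_zero_or_pos k with rfl | hk
  · rw [Finset.sum_eq_zero]
    · have h : π⁻¹ * 2⁻¹ * (2 * π) = 1 := by field_simp
      simp [h]
    · intro j hj
      have hj' : j ≠ 0 := by have := (Finset.mem_Icc.1 hj).1; omega
      simp [hj']
  · have h0 (j : ℕ) : (j : ℤ) + k ≠ 0 := by omega
    have hk0 : (0 : ℕ) ≠ k := hk.ne
    simp only [h0, if_false, hk0]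
    have (j : ℕ) : (1 / π) • (((0 + if j = k then 2 * π else 0) / 2) • cosF j + (0 : ℝ) • sinF j) =
        if j = k then cosF k else 0 := by
      split_ifs with h
      · subst h; simp [smul_smul, hpi]
      · simp
    simp only [this, Finset.sum_ite_eq', Finset.mem_Icc]
    have : (1 ≤ k ∧ k ≤ n) ↔ k ≤ n := by omega
    simp [this]

lemma fourierProj_sinF (n k : ℕ) : fourierProj n (sinF k) = if k ≤ n then sinF k else 0 := by
  have hpi := Real.pi_ne_zero
  rcases Nat.eq_zero_or_pos k with rfl | hk
  · simp [sinF_zero]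
  rw [fourierProj_apply]
  simp only [coeffCLM_apply, integral_cosF_mul_sinF, integral_sinF_mul_sinF]
  have h0 (j : ℕ) : (j : ℤ) + k ≠ 0 := by omega
  simp only [h0, if_false]
  have (j : ℕ) : (1 / π) • ((0 : ℝ) • cosF j + (((if j = k then 2 * π else 0) - 0) / 2) • sinF j) =
      if j = k then sinF k else 0 := by
    split_ifs with h
    · subst h; simp [smul_smul, hpi]
    · simp
  simp only [this, Finset.sum_ite_eq', Finset.mem_Icc]
  have : (1 ≤ k ∧ k ≤ n) ↔ k ≤ n := by omega
  simp [this]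

/-- Pointwise real part as a real-linear map. -/
noncomputable def reMap : C(AddCircle (2 * π), ℂ) →L[ℝ] C2pi :=
  Complex.reCLM.compLeftContinuous ℝ (AddCircle (2 * π))

lemma reMap_apply (f : C(AddCircle (2 * π), ℂ)) (x : AddCircle (2 * π)) :
    reMap f x = (f x).re := rfl

lemma dense_span_cosF_sinF :
    Dense (Submodule.span ℝ {f : C2pi | ∃ k : ℕ, f = cosF k ∨ f = sinF k} : Set C2pi) := by
  set S := Submodule.span ℝ {f : C2pi | ∃ k : ℕ, f = cosF k ∨ f = sinF k}
  have hcos (k : ℕ) : cosF k ∈ S := Submodule.subset_span ⟨k, .inl rfl⟩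
  have hsin (k : ℕ) : sinF k ∈ S := Submodule.subset_span ⟨k, .inr rfl⟩
  have hspan (p) (hp : p ∈ Submodule.span ℂ (Set.range (@fourier (2 * π)))) :
      ∀ c : ℂ, reMap (c • p) ∈ S := by
    induction hp using Submodule.span_induction with
    | mem p hp =>
      obtain ⟨m, rfl⟩ := hp
      intro c
      obtain ⟨k, rfl | rfl⟩ := m.eq_nat_or_neg
      · have : reMap (c • fourier (k : ℤ)) = c.re • cosF k - c.im • sinF k := by
          ext x
          simp [reMap_apply, cosF_apply, sinF_apply, -fourier_apply]
        rw [this]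
        exact S.sub_mem (S.smul_mem _ (hcos k)) (S.smul_mem _ (hsin k))
      · have : reMap (c • fourier (-(k : ℤ))) = c.re • cosF k + c.im • sinF k := by
          ext x
          simp only [reMap_apply, ContinuousMap.smul_apply, ContinuousMap.add_apply, smul_eq_mul,
            fourier_neg, Complex.mul_re, Complex.conj_re, Complex.conj_im, cosF_apply, sinF_apply]
          ring
        rw [this]
        exact S.add_mem (S.smul_mem _ (hcos k)) (S.smul_mem _ (hsin k))
    | zero => simp
    | add p q _ _ hp hq =>
      intro c
      rw [smul_add, map_add]
      exact S.add_mem (hp c) (hq c)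
    | smul a p _ hp =>
      intro c
      rw [smul_smul]
      exact hp _
  intro f
  let F : C(AddCircle (2 * π), ℂ) := ⟨fun x => (f x : ℂ), by fun_prop⟩
  have hF : F ∈ closure (Submodule.span ℂ (Set.range (@fourier (2 * π))) : Set _) := by
    rw [← Submodule.topologicalClosure_coe, span_fourier_closure_eq_top]
    trivial
  have hre : reMap F = f := by
    ext x
    simp [reMap_apply, F]
  rw [← hre]
  exact map_mem_closure reMap.continuous hF fun p hp => by simpa using hspan p hp 1

/-- Translation of `f` by a point of the circle. -/
noncomputable def shift (u : AddCircle (2 * π)) (f : C2pi) : C2pi :=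
  f.comp ⟨fun t => t + u, by fun_prop⟩

lemma shift_apply (u : AddCircle (2 * π)) (f : C2pi) (x : AddCircle (2 * π)) :
    shift u f x = f (x + u) := rfl

lemma continuous_shift : Continuous fun p : C2pi × AddCircle (2 * π) => shift p.2 p.1 := by
  have h : Continuous fun u : AddCircle (2 * π) =>
      (⟨fun t => t + u, by fun_prop⟩ : C(AddCircle (2 * π), AddCircle (2 * π))) :=
    ContinuousMap.continuous_of_continuous_uncurry _ (by
      change Continuous fun p : AddCircle (2 * π) × AddCircle (2 * π) => p.2 + p.1
      fun_prop)
  exact continuous_fst.compCM (h.comp continuous_snd)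

lemma shift_cosF (k : ℕ) (u : AddCircle (2 * π)) :
    shift u (cosF k) = cosF k u • cosF k - sinF k u • sinF k := by
  ext x
  have h : fourier (k : ℤ) (x + u) = fourier (k : ℤ) x * fourier (k : ℤ) u := by
    simp [fourier_apply, smul_add, toCircle_add]
  simp only [shift_apply, cosF_apply, sinF_apply, ContinuousMap.sub_apply, ContinuousMap.smul_apply,
    smul_eq_mul, h, Complex.mul_re]
  ring

lemma shift_sinF (k : ℕ) (u : AddCircle (2 * π)) :
    shift u (sinF k) = cosF k u • sinF k + sinF k u • cosF k := by
  ext x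
  have h : fourier (k : ℤ) (x + u) = fourier (k : ℤ) x * fourier (k : ℤ) u := by
    simp [fourier_apply, smul_add, toCircle_add]
  simp only [shift_apply, cosF_apply, sinF_apply, ContinuousMap.add_apply, ContinuousMap.smul_apply,
    smul_eq_mul, h, Complex.mul_im]
  ring

lemma cosF_neg (k : ℕ) (u : AddCircle (2 * π)) : cosF k (-u) = cosF k u := by
  have h : fourier (k : ℤ) (-u) = fourier (-(k : ℤ)) u := by simp [fourier_apply]
  rw [cosF_apply, h, fourier_neg, Complex.conj_re, cosF_apply]

lemma sinF_neg (k : ℕ) (u : AddCircle (2 * π)) : sinF k (-u) = -sinF k u := by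
  have h : fourier (k : ℤ) (-u) = fourier (-(k : ℤ)) u := by simp [fourier_apply]
  rw [sinF_apply, h, fourier_neg, Complex.conj_im, sinF_apply]

lemma cosF_sub (k : ℕ) (t u : AddCircle (2 * π)) :
    cosF k (t - u) = cosF k t * cosF k u + sinF k t * sinF k u := by
  rw [sub_eq_add_neg, ← shift_apply, shift_cosF]
  simp [cosF_neg, sinF_neg, mul_comm]

lemma sinF_sub (k : ℕ) (t u : AddCircle (2 * π)) :
    sinF k (t - u) = sinF k t * cosF k u - cosF k t * sinF k u := by
  rw [sub_eq_add_neg, ← shift_apply, shift_sinF]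
  simp [cosF_neg, sinF_neg, mul_comm, sub_eq_add_neg]

lemma cosF_mem_trigPoly {n k : ℕ} (h : k ≤ n) : cosF k ∈ trigPoly n :=
  Submodule.subset_span ⟨k, h, .inl rfl⟩

lemma sinF_mem_trigPoly {n k : ℕ} (h : k ≤ n) : sinF k ∈ trigPoly n :=
  Submodule.subset_span ⟨k, h, .inr rfl⟩

lemma integrable_mul_reflect (e p : C2pi) (t : AddCircle (2 * π)) :
    Integrable fun u => e u * p (t - u) :=
  integrable_C2pi ⟨fun u => e u * p (t - u), by fun_prop⟩

/-- A harmonic of degree `k > n` is orthogonal to the reflected translates of `trigPoly n`. -/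
lemma integral_mul_reflect_eq_zero {n k : ℕ} (h : n < k) {e : C2pi} (he : e = cosF k ∨ e = sinF k)
    {p : C2pi} (hp : p ∈ trigPoly n) (t : AddCircle (2 * π)) :
    ∫ u, e u * p (t - u) = 0 := by
  have horth {j : ℕ} (hj : j ≤ n) :
      (∫ u, e u * cosF j u = 0) ∧ ∫ u, e u * sinF j u = 0 := by
    have hkj : k ≠ j := by omega
    have hkj' : (k : ℤ) + j ≠ 0 := by omega
    rcases he with rfl | rfl
    · simp [integral_cosF_mul_cosF, integral_cosF_mul_sinF, hkj, hkj']
    · simp [integral_sinF_mul_cosF, integral_sinF_mul_sinF, hkj, hkj']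
  have hlin (a b : ℝ) (f g : C2pi) :
      ∫ u, (a * (e u * f u) + b * (e u * g u)) =
        a * (∫ u, e u * f u) + b * ∫ u, e u * g u := by
    have hf : Integrable fun u => e u * f u := integrable_C2pi (e * f)
    have hg : Integrable fun u => e u * g u := integrable_C2pi (e * g)
    rw [integral_add (hf.const_mul a) (hg.const_mul b), integral_const_mul, integral_const_mul]
  induction hp using Submodule.span_induction with
  | mem p hp =>
    obtain ⟨j, hj, rfl | rfl⟩ := hp
    · have := hlin (cosF j t) (sinF j t) (cosF j) (sinF j)
      rw [(horth hj).1, (horth hj).2] at this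
      simp only [mul_zero, add_zero] at this
      rw [← this]
      congr 1 with u
      rw [cosF_sub]
      ring
    · have := hlin (sinF j t) (-cosF j t) (cosF j) (sinF j)
      rw [(horth hj).1, (horth hj).2] at this
      simp only [mul_zero, add_zero] at this
      rw [← this]
      congr 1 with u
      rw [sinF_sub]
      ring
  | zero => simp
  | add p q _ _ hp hq =>
    simp only [ContinuousMap.add_apply, mul_add]
    rw [integral_add (integrable_mul_reflect _ _ _) (integrable_mul_reflect _ _ _), hp, hq,
      add_zero]
  | smul a p _ hp =>
    simp only [ContinuousMap.smul_apply, smul_eq_mul, mul_left_comm _ a]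
    rw [integral_const_mul, hp, mul_zero]

lemma continuous_conj_shift (P : C2pi →L[ℝ] C2pi) (t : AddCircle (2 * π)) :
    Continuous fun p : C2pi × AddCircle (2 * π) => P (shift p.2 p.1) (t - p.2) :=
  ContinuousEval.continuous_eval.comp
    ((P.continuous.comp continuous_shift).prodMk (by fun_prop))

lemma integrable_conj_shift (P : C2pi →L[ℝ] C2pi) (f : C2pi) (t : AddCircle (2 * π)) :
    Integrable fun u => P (shift u f) (t - u) :=
  integrable_C2pi ⟨_, (continuous_conj_shift P t).comp (Continuous.prodMk_right f)⟩

/-- The functional `f ↦ ∫ (T_{-u} P T_u f)(t) du`. -/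
noncomputable def conjIntegral (P : C2pi →L[ℝ] C2pi) (t : AddCircle (2 * π)) : C2pi →L[ℝ] ℝ where
  toFun f := ∫ u, P (shift u f) (t - u)
  map_add' f g := by
    rw [← integral_add (integrable_conj_shift P f t) (integrable_conj_shift P g t)]
    congr 1 with u
    have : shift u (f + g) = shift u f + shift u g := rfl
    simp [this]
  map_smul' a f := by
    rw [RingHom.id_apply, smul_eq_mul, ← integral_const_mul]
    congr 1 with u
    have : shift u (a • f) = a • shift u f := rfl
    simp [this]
  cont := by
    have h (f : C2pi) : ∫ u, P (shift u f) (t - u) =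
        ∫ g in (0 : ℝ)..(0 + 2 * π), P (shift (g : AddCircle (2 * π)) f) (t - g) :=
      (AddCircle.intervalIntegral_preimage (2 * π) 0 fun u => P (shift u f) (t - u)).symm
    change Continuous fun f => ∫ u, P (shift u f) (t - u)
    simp_rw [h]
    refine intervalIntegral.continuous_parametric_intervalIntegral_of_continuous' ?_ _ _
    exact (continuous_conj_shift P t).comp
      (continuous_fst.prodMk ((AddCircle.continuous_mk' (2 * π)).comp continuous_snd))

lemma conjIntegral_apply (P : C2pi →L[ℝ] C2pi) (t : AddCircle (2 * π)) (f : C2pi) :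
    conjIntegral P t f = ∫ u, P (shift u f) (t - u) := rfl

lemma conjIntegral_of_forall_shift_eq {P : C2pi →L[ℝ] C2pi} {f : C2pi}
    (h : ∀ u, P (shift u f) = shift u f) (t : AddCircle (2 * π)) :
    conjIntegral P t f = 2 * π * f t := by
  simp [conjIntegral_apply, h, shift_apply, Measure.real, AddCircle.measure_univ,
    ENNReal.toReal_ofReal Real.pi_pos.le]

/-- Marcinkiewicz equality: for every projection `P` of `C(2π)` onto `Π_n`, every
`f ∈ C(2π)` and every `t`, `F_n f(t) = (1/2π) ∫₀^{2π} (T_{g⁻¹} P T_g f)(t) dg`. -/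
theorem marcinkiewicz_equality (n : ℕ) (P : C2pi →L[ℝ] C2pi)
    (hPrange : ∀ f : C2pi, P f ∈ trigPoly n)
    (hPproj : ∀ f ∈ trigPoly n, P f = f)
    (f : C2pi) (t : AddCircle (2 * π)) :
    fourierProj n f t =
      (1 / (2 * π)) * ∫ g in (0 : ℝ)..(2 * π), (translateBy (-g) (P (translateBy g f))) t := by
  have h_avg : ∫ g in (0 : ℝ)..(2 * π), (translateBy (-g) (P (translateBy g f))) t =
      conjIntegral P t f := by
    rw [conjIntegral_apply, ← AddCircle.intervalIntegral_preimage (2 * π) 0, zero_add]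
    rfl
  rw [h_avg]
  suffices h : (ContinuousMap.evalCLM ℝ t).comp (fourierProj n) =
      (1 / (2 * π)) • conjIntegral P t from DFunLike.congr_fun h f
  refine ContinuousLinearMap.ext_on dense_span_cosF_sinF ?_
  rintro e ⟨k, he⟩
  change fourierProj n e t = (1 / (2 * π)) * conjIntegral P t e
  by_cases hk : k ≤ n
  · have hproj : fourierProj n e = e := by
      rcases he with rfl | rfl <;> simp [fourierProj_cosF, fourierProj_sinF, hk]
    rw [hproj, conjIntegral_of_forall_shift_eq fun u => hPproj _ ?_]
    · field_simp
    · have hc := cosF_mem_trigPoly hk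
      have hs := sinF_mem_trigPoly hk
      rcases he with rfl | rfl
      · rw [shift_cosF]
        exact Submodule.sub_mem _ (Submodule.smul_mem _ _ hc) (Submodule.smul_mem _ _ hs)
      · rw [shift_sinF]
        exact Submodule.add_mem _ (Submodule.smul_mem _ _ hs) (Submodule.smul_mem _ _ hc)
  · have hproj : fourierProj n e = 0 := by
      rcases he with rfl | rfl <;> simp [fourierProj_cosF, fourierProj_sinF, hk]
    have hcos (g : C2pi) : ∫ u, cosF k u * P g (t - u) = 0 :=
      integral_mul_reflect_eq_zero (not_le.1 hk) (.inl rfl) (hPrange g) t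
    have hsin (g : C2pi) : ∫ u, sinF k u * P g (t - u) = 0 :=
      integral_mul_reflect_eq_zero (not_le.1 hk) (.inr rfl) (hPrange g) t
    have hzero : conjIntegral P t e = 0 := by
      rw [conjIntegral_apply]
      rcases he with rfl | rfl
      · simp only [shift_cosF, map_sub, map_smul, ContinuousMap.sub_apply,
          ContinuousMap.smul_apply, smul_eq_mul]
        rw [integral_sub (integrable_mul_reflect _ _ _) (integrable_mul_reflect _ _ _), hcos, hsin,
          sub_zero]
      · simp only [shift_sinF, map_add, map_smul, ContinuousMap.add_apply,
          ContinuousMap.smul_apply, smul_eq_mul]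
        rw [integral_add (integrable_mul_reflect _ _ _) (integrable_mul_reflect _ _ _), hcos, hsin,
          add_zero]
    rw [hproj, hzero]
    simp
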